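/- Let p, m, n ∈ ℕ, let a, b ∈ ℝ with a, b > 0, and let α ∈ ℝ with α > −1. Define 𝓛(p,m,n;α;a,b) := ∫_{0}^{∞} L_p^α(x)·L_m^α(ax)·L_n^α(bx)·x^α e^{−x} dx, with the convention L_{−1}^α := 0, and write 𝓛 := 𝓛(p,m,n;α;a,b), 𝓛₁^± := 𝓛(p±1,m,n;α;a,b), 𝓛₂^± := 𝓛(p,m±1,n;α;a,b), 𝓛₃^± := 𝓛(p,m,n±1;α;a,b). Then: (i) a(p+α)𝓛₁^− − (m+α)𝓛₂^− + (2m+α+1)𝓛 − a(2p+α+1)𝓛 − (m+1)𝓛₂^+ + a(p+1)𝓛₁^+ = 0; (ii) b(p+α)𝓛₁^− − (n+α)𝓛₃^− + (2n+α+1)𝓛 − b(2p+α+1)𝓛 − (n+1)𝓛₃^+ + b(p+1)𝓛₁^+ = 0; (iii) b(m+α)𝓛₂^− − a(n+α)𝓛₃^− + a(2n+α+1)𝓛 − b(2m+α+1)𝓛 − a(n+1)𝓛₃^+ + b(m+1)𝓛₂^+ = 0. -/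

import Mathlib

open MeasureTheory

/-- Pochhammer symbol `(a)_j` for real `a` and natural `j`. -/
noncomputable def poch (a : ℝ) (j : ℕ) : ℝ := (ascPochhammer ℝ j).eval a

/-- Pochhammer symbol `(a)_j` for integer index, with the convention
`(a)_{-j} = 1/((a-1)(a-2)⋯(a-j))` for `j ≥ 1`. -/
noncomputable def pochZ (a : ℝ) (j : ℤ) : ℝ :=
  if 0 ≤ j then poch a j.toNat
  else (∏ i ∈ Finset.range (-j).toNat, (a - (i + 1)))⁻¹

/-- Factorial of an integer: `j!` for `j ≥ 0` and `0` for `j < 0`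
(encoding `1/(negative integer)! = 0` via Lean's division by zero). -/
noncomputable def ifact (j : ℤ) : ℝ := if 0 ≤ j then (j.toNat.factorial : ℝ) else 0

/-- Generalized hypergeometric sum `ᵣF_s(a; b; z)` (intended for terminating series,
where all terms beyond the termination index vanish). -/
noncomputable def hypSum (a b : List ℝ) (z : ℝ) : ℝ :=
  ∑' j : ℕ, ((a.map fun t => poch t j).prod /
    ((b.map fun t => poch t j).prod * (j.factorial : ℝ))) * z ^ j

/-- Laguerre polynomial `L_n^α(x)`. -/
noncomputable def lagL (α : ℝ) (n : ℕ) (x : ℝ) : ℝ :=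
  ∑ k ∈ Finset.range (n + 1),
    (-1) ^ k * poch (α + k + 1) (n - k) / (((n - k).factorial : ℝ) * k.factorial) * x ^ k

/-- Laguerre polynomial with integer index, convention `L_{-1}^α := 0` (indeed `0` for all
negative indices). -/
noncomputable def lagLZ (α : ℝ) (n : ℤ) (x : ℝ) : ℝ :=
  if 0 ≤ n then lagL α n.toNat x else 0

/-- The integral `𝓛(p,m,n;α;a,b)` of a product of three Laguerre polynomials, two of them
scaled, against `x^α e^{-x}` on `(0,∞)`. -/
noncomputable def LintS (α a b : ℝ) (p m n : ℤ) : ℝ :=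
  ∫ x in Set.Ioi (0 : ℝ),
    lagLZ α p x * lagLZ α m (a * x) * lagLZ α n (b * x) * x ^ α * Real.exp (-x)

open Polynomial in
/-- The Laguerre polynomial `L_n^α` as an element of `ℝ[X]`. -/
noncomputable def lagPoly (α : ℝ) (n : ℕ) : ℝ[X] :=
  ∑ k ∈ Finset.range (n + 1),
    C ((-1) ^ k * poch (α + k + 1) (n - k) / (((n - k).factorial : ℝ) * k.factorial)) * X ^ k

theorem eval_lagPoly (α : ℝ) (n : ℕ) (x : ℝ) : (lagPoly α n).eval x = lagL α n x := by
  simp [lagPoly, lagL, Polynomial.eval_finsetSum]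

theorem coeff_lagPoly_add (α : ℝ) (j k : ℕ) :
    (lagPoly α (k + j)).coeff k =
      (-1) ^ k * poch (α + k + 1) j / ((j.factorial : ℝ) * k.factorial) := by
  simp [lagPoly, Polynomial.coeff_X_pow]

theorem coeff_lagPoly_of_lt (α : ℝ) {n k : ℕ} (h : n < k) : (lagPoly α n).coeff k = 0 := by
  have : ¬ k < n + 1 := by omega
  simp [lagPoly, Polynomial.coeff_X_pow, this]

theorem poch_zero (x : ℝ) : poch x 0 = 1 := by simp [poch]

theorem poch_succ_right (x : ℝ) (j : ℕ) : poch x (j + 1) = poch x j * (x + j) := by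
  simp [poch, ascPochhammer_succ_right]

theorem poch_succ_left (x : ℝ) (j : ℕ) : poch x (j + 1) = x * poch (x + 1) j := by
  simp [poch, ascPochhammer_succ_left, Polynomial.eval_comp]

open Polynomial in
theorem lagPoly_zero (α : ℝ) : lagPoly α 0 = 1 := by
  simp [lagPoly, poch_zero]

open Polynomial in
theorem lagPoly_one (α : ℝ) : lagPoly α 1 = C (α + 1) - X := by
  simp [lagPoly, poch_zero, poch_succ_right, Finset.sum_range_succ, sub_eq_add_neg]

open Polynomial in
theorem lagPoly_recurrence (α : ℝ) (n : ℕ) :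
    C ((n : ℝ) + 2) * lagPoly α (n + 2) =
      C (2 * (n : ℝ) + α + 3) * lagPoly α (n + 1) - X * lagPoly α (n + 1)
        - C ((n : ℝ) + 1 + α) * lagPoly α n := by
  ext k
  simp only [coeff_sub, coeff_C_mul]
  rcases k with _ | k
  · have h := fun i => coeff_lagPoly_add α i 0
    simp only [zero_add] at h
    have hf : (n.factorial : ℝ) ≠ 0 := by positivity
    simp only [h, coeff_X_mul_zero, poch_succ_right, Nat.factorial_succ]
    push_cast
    field_simp
    ring
  · rw [coeff_X_mul]
    rcases lt_or_ge n k with h | h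
    · rw [coeff_lagPoly_of_lt α (by omega : n < k + 1)]
      rw [coeff_lagPoly_of_lt α (by omega : n + 1 < k + 1)]
      rcases lt_or_ge (n + 1) k with h' | h'
      · rw [coeff_lagPoly_of_lt α (by omega : n + 2 < k + 1), coeff_lagPoly_of_lt α h']
        simp
      · obtain rfl : k = n + 1 := by omega
        have h1 := coeff_lagPoly_add α 0 (n + 1)
        have h2 := coeff_lagPoly_add α 0 (n + 1 + 1)
        simp only [add_zero] at h1 h2
        have hf : (n.factorial : ℝ) ≠ 0 := by positivity
        rw [h1, h2]
        simp only [poch_zero, Nat.factorial_succ, pow_succ]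
        push_cast
        field_simp
        ring
    · obtain ⟨j, rfl⟩ := Nat.exists_eq_add_of_le h
      have hk : (k.factorial : ℝ) ≠ 0 := by positivity
      have hj : (j.factorial : ℝ) ≠ 0 := by positivity
      have h2 := coeff_lagPoly_add α (j + 1) (k + 1)
      have h1 := coeff_lagPoly_add α j (k + 1)
      have h1' := coeff_lagPoly_add α (j + 1) k
      rw [show k + 1 + (j + 1) = k + j + 2 by ring] at h2
      rw [show k + 1 + j = k + j + 1 by ring] at h1
      rw [← add_assoc, poch_succ_left] at h1'
      rw [h2, h1, h1']
      rcases j with _ | j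
      · rw [coeff_lagPoly_of_lt α (by omega : k + 0 < k + 1)]
        simp only [poch_succ_right, poch_zero, Nat.factorial_succ, pow_succ]
        push_cast
        field_simp
        ring
      · have h0 := coeff_lagPoly_add α j (k + 1)
        rw [show k + 1 + j = k + (j + 1) by ring] at h0
        rw [h0]
        have hj' : (j.factorial : ℝ) ≠ 0 := by positivity
        simp only [poch_succ_right, Nat.factorial_succ, pow_succ]
        push_cast
        rw [show α + (k : ℝ) + 1 + 1 = α + (k + 1) + 1 by ring]
        field_simp
        ring

open Polynomial in
/-- The Laguerre polynomial with integer index, zero for negative indices. -/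
noncomputable def lagPolyZ (α : ℝ) (n : ℤ) : ℝ[X] := if 0 ≤ n then lagPoly α n.toNat else 0

theorem eval_lagPolyZ (α : ℝ) (n : ℤ) (x : ℝ) : (lagPolyZ α n).eval x = lagLZ α n x := by
  unfold lagPolyZ lagLZ
  split_ifs <;> simp [eval_lagPoly]

theorem lagPolyZ_natCast (α : ℝ) (n : ℕ) : lagPolyZ α n = lagPoly α n := by
  simp [lagPolyZ]

open Polynomial in
theorem lagPolyZ_recurrence (α : ℝ) (n : ℕ) :
    C ((n : ℝ) + 1) * lagPolyZ α ((n : ℤ) + 1) =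
      C (2 * (n : ℝ) + α + 1) * lagPolyZ α n - X * lagPolyZ α n
        - C ((n : ℝ) + α) * lagPolyZ α ((n : ℤ) - 1) := by
  rcases n with _ | n
  · have h1 : lagPolyZ α ((0 : ℕ) + 1) = lagPoly α 1 := lagPolyZ_natCast α 1
    have h0 : lagPolyZ α ((0 : ℕ) - 1) = 0 := by simp [lagPolyZ]
    rw [h1, h0, lagPolyZ_natCast, lagPoly_zero, lagPoly_one]
    simp
  · have h2 : lagPolyZ α ((n + 1 : ℕ) + 1) = lagPoly α (n + 2) := lagPolyZ_natCast α (n + 2)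
    have h0 : lagPolyZ α ((n + 1 : ℕ) - 1) = lagPoly α n := by
      rw [← lagPolyZ_natCast]; congr 1; push_cast; ring
    have h := lagPoly_recurrence α n
    rw [h2, h0, lagPolyZ_natCast]
    convert h using 3
    · push_cast; ring_nf
    · push_cast; ring_nf
    · push_cast; ring_nf

theorem integrableOn_polynomial_mul_rpow_mul_exp_neg {α : ℝ} (hα : -1 < α)
    (P : Polynomial ℝ) :
    IntegrableOn (fun x => P.eval x * x ^ α * Real.exp (-x)) (Set.Ioi 0) := by
  induction P using Polynomial.induction_on' with
  | add P Q hP hQ =>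
    refine (hP.add hQ).congr_fun (fun x _ => ?_) measurableSet_Ioi
    simp only [Polynomial.eval_add, Pi.add_apply]
    ring
  | monomial k c =>
    have hk : (0 : ℝ) < α + k + 1 := by
      have : (0 : ℝ) ≤ k := k.cast_nonneg
      linarith
    have h : IntegrableOn (fun x => c * (Real.exp (-x) * x ^ (α + k + 1 - 1))) (Set.Ioi 0) :=
      (Real.GammaIntegral_convergent hk).const_mul c
    refine h.congr_fun (fun x hx => ?_) measurableSet_Ioi
    have hx' : (0 : ℝ) < x := hx
    simp only [Polynomial.eval_monomial, add_sub_cancel_right, Real.rpow_add hx',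
      Real.rpow_natCast]
    ring

/-- Integration of polynomials against `x^α e^{-x}` on `(0,∞)`, as a linear functional. -/
noncomputable def laguerreFunctional {α : ℝ} (hα : -1 < α) : Polynomial ℝ →ₗ[ℝ] ℝ where
  toFun P := ∫ x in Set.Ioi (0 : ℝ), P.eval x * x ^ α * Real.exp (-x)
  map_add' P Q := by
    rw [← integral_add (integrableOn_polynomial_mul_rpow_mul_exp_neg hα P)
      (integrableOn_polynomial_mul_rpow_mul_exp_neg hα Q)]
    simp only [Polynomial.eval_add, add_mul]
  map_smul' c P := by
    rw [RingHom.id_apply, smul_eq_mul, ← integral_const_mul]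
    simp only [Polynomial.eval_smul, smul_eq_mul, mul_assoc]

open Polynomial in
/-- The scaled Laguerre polynomial `x ↦ L_n^α(c x)`. -/
noncomputable def lagPolyScaled (α c : ℝ) (n : ℤ) : ℝ[X] := (lagPolyZ α n).comp (C c * X)

open Polynomial in
theorem lagPolyScaled_recurrence (α c : ℝ) (n : ℕ) :
    C ((n : ℝ) + 1) * lagPolyScaled α c ((n : ℤ) + 1) =
      C (2 * (n : ℝ) + α + 1) * lagPolyScaled α c n - C c * X * lagPolyScaled α c n
        - C ((n : ℝ) + α) * lagPolyScaled α c ((n : ℤ) - 1) := by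
  have h := congrArg (fun P : ℝ[X] => P.comp (C c * X)) (lagPolyZ_recurrence α n)
  simpa only [lagPolyScaled, mul_comp, sub_comp, C_comp, X_comp] using h

theorem LintS_eq_laguerreFunctional {α : ℝ} (hα : -1 < α) (a b : ℝ) (p m n : ℤ) :
    LintS α a b p m n = laguerreFunctional hα
      (lagPolyZ α p * lagPolyScaled α a m * lagPolyScaled α b n) := by
  simp [LintS, laguerreFunctional, lagPolyScaled, eval_lagPolyZ]

theorem stmt19 (p m n : ℕ) (a b : ℝ) (ha : 0 < a) (hb : 0 < b) (α : ℝ) (hα : -1 < α) :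
    (a * ((p : ℝ) + α) * LintS α a b ((p : ℤ) - 1) m n
        - ((m : ℝ) + α) * LintS α a b p ((m : ℤ) - 1) n
        + (2 * (m : ℝ) + α + 1) * LintS α a b p m n
        - a * (2 * (p : ℝ) + α + 1) * LintS α a b p m n
        - ((m : ℝ) + 1) * LintS α a b p ((m : ℤ) + 1) n
        + a * ((p : ℝ) + 1) * LintS α a b ((p : ℤ) + 1) m n = 0) ∧
    (b * ((p : ℝ) + α) * LintS α a b ((p : ℤ) - 1) m n
        - ((n : ℝ) + α) * LintS α a b p m ((n : ℤ) - 1)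
        + (2 * (n : ℝ) + α + 1) * LintS α a b p m n
        - b * (2 * (p : ℝ) + α + 1) * LintS α a b p m n
        - ((n : ℝ) + 1) * LintS α a b p m ((n : ℤ) + 1)
        + b * ((p : ℝ) + 1) * LintS α a b ((p : ℤ) + 1) m n = 0) ∧
    (b * ((m : ℝ) + α) * LintS α a b p ((m : ℤ) - 1) n
        - a * ((n : ℝ) + α) * LintS α a b p m ((n : ℤ) - 1)
        + a * (2 * (n : ℝ) + α + 1) * LintS α a b p m n
        - b * (2 * (m : ℝ) + α + 1) * LintS α a b p m n
        - a * ((n : ℝ) + 1) * LintS α a b p m ((n : ℤ) + 1)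
        + b * ((m : ℝ) + 1) * LintS α a b p ((m : ℤ) + 1) n = 0) := by
  simp only [LintS_eq_laguerreFunctional hα, ← smul_eq_mul (a := (_ : ℝ)) (b := laguerreFunctional hα _),
    ← map_smul, ← map_add, ← map_sub]
  have hp := lagPolyZ_recurrence α p
  have hm := lagPolyScaled_recurrence α a m
  have hn := lagPolyScaled_recurrence α b n
  set P := lagPolyZ α p
  set M := lagPolyScaled α a m
  set N := lagPolyScaled α b n
  refine ⟨?_, ?_, ?_⟩
  all_goals
    rw [← map_zero (laguerreFunctional hα)]
    congr 1
    simp only [Polynomial.smul_eq_C_mul, map_mul]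
  · linear_combination Polynomial.C a * M * N * hp - P * N * hm
  · linear_combination Polynomial.C b * M * N * hp - P * M * hn
  · linear_combination Polynomial.C b * P * N * hm - Polynomial.C a * P * M * hn
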